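/- Let H be an affine algebraic group over an algebraically closed field C of characteristic zero, N a normal closed subgroup of H, and χ : N → C^× a character (morphism of algebraic groups). Then there exists a nonzero regular function a ∈ C[H] that is a χ-semi-invariant for the right translation action of N: for every h ∈ N, h·a = χ(h)·a, where (h·a)(x) = a(xh). -/

import Mathlib

open MvPolynomial

namespace RegularFunctions

variable {K G : Type*} [Field K]

theorem exists_det_apply_ne_zero {X ι : Type*} [Fintype ι] [DecidableEq ι] {u : ι → X → K}
    (hu : LinearIndependent K u) : ∃ x : ι → X, (Matrix.of fun i j => u i (x j)).det ≠ 0 := by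
  let c : X → ι → K := fun x i => u i x
  have hc : Submodule.span K (Set.range c) = ⊤ := by
    by_contra h
    obtain ⟨φ, hφ, hle⟩ := Submodule.exists_le_ker_of_lt_top _ (lt_top_iff_ne_top.2 h)
    have key : ∑ i, φ (Pi.single i 1) • u i = 0 := by
      funext x
      have h1 : φ (c x) = 0 := hle (Submodule.subset_span ⟨x, rfl⟩)
      have hs : ∀ i : ι, (fun j => if i = j then (1 : K) else 0) = Pi.single i 1 := fun i => by
        funext j
        simp [Pi.single_apply, eq_comm]
      rw [LinearMap.pi_apply_eq_sum_univ φ (c x)] at h1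
      simpa [c, mul_comm, hs, Finset.sum_apply] using h1
    have h0 := Fintype.linearIndependent_iff.1 hu _ key
    refine hφ (LinearMap.pi_ext' fun i => LinearMap.ext_ring ?_)
    simpa using h0 i
  obtain ⟨κ, a, -, hspan, hli⟩ := exists_linearIndependent' K c
  let b := Module.Basis.mk hli (by rw [hspan, hc])
  let e : ι ≃ κ := (Pi.basisFun K ι).indexEquiv b
  refine ⟨a ∘ e, ?_⟩
  rw [← Matrix.det_transpose, ← isUnit_iff_ne_zero, ← Matrix.isUnit_iff_isUnit_det,
    ← Matrix.linearIndependent_rows_iff_isUnit]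
  exact hli.comp e e.injective

theorem det_mem (A : Subalgebra K (G → K)) {ι : Type*} [Fintype ι] [DecidableEq ι]
    (M : G → Matrix ι ι K) (hM : ∀ i j, (fun x => M x i j) ∈ A) : (fun x => (M x).det) ∈ A := by
  have : (fun x => (M x).det) =
      ∑ σ : Equiv.Perm ι, (σ.sign : ℤ) • ∏ i, fun x => M x (σ i) i := by
    funext x
    simp [Matrix.det_apply, Finset.sum_apply, Finset.prod_apply, Units.smul_def]
  rw [this]
  exact sum_mem fun σ _ => zsmul_mem (prod_mem fun i _ => hM _ _) _

/-- The span of the functions `(x, y) ↦ a x * b y` with `a`, `b` in `A`. -/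
def pureSpan (A : Subalgebra K (G → K)) : Submodule K (G × G → K) :=
  Submodule.span K {F | ∃ a ∈ A, ∃ b ∈ A, F = fun p => a p.1 * b p.2}

theorem slice_mem {A : Subalgebra K (G → K)} {F : G × G → K} (hF : F ∈ pureSpan A)
    (L : (G → K) →ₗ[K] K) : (fun y => L fun x => F (x, y)) ∈ A := by
  induction hF using Submodule.span_induction with
  | mem F hF =>
    obtain ⟨a, ha, b, hb, rfl⟩ := hF
    convert A.smul_mem hb (L a) using 1
    funext y
    have : (fun x => a x * b y) = b y • a := by
      funext x
      simp [mul_comm]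
    simp [this, mul_comm]
  | zero =>
    convert A.zero_mem using 1
    funext y
    exact map_zero L
  | add F F' _ _ h h' =>
    convert A.add_mem h h' using 1
    funext y
    exact map_add L _ _
  | smul c F _ h =>
    convert A.smul_mem h c using 1
    funext y
    exact map_smul L c _

theorem exists_finite_slice {A : Subalgebra K (G → K)} {F : G × G → K} (hF : F ∈ pureSpan A) :
    ∃ W ≤ Subalgebra.toSubmodule A, FiniteDimensional K W ∧ ∀ y, (fun x => F (x, y)) ∈ W := by
  induction hF using Submodule.span_induction with
  | mem F hF =>
    obtain ⟨a, ha, b, hb, rfl⟩ := hF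
    refine ⟨K ∙ a, by simpa using ha, inferInstance, fun y => ?_⟩
    exact Submodule.mem_span_singleton.2 ⟨b y, by funext x; simp [mul_comm]⟩
  | zero => exact ⟨⊥, bot_le, inferInstance, fun y => rfl⟩
  | add F F' _ _ h h' =>
    obtain ⟨W, hW, _, h⟩ := h
    obtain ⟨W', hW', _, h'⟩ := h'
    exact ⟨W ⊔ W', sup_le hW hW', inferInstance, fun y => Submodule.add_mem_sup (h y) (h' y)⟩
  | smul c F _ h =>
    obtain ⟨W, hW, hfin, h⟩ := h
    exact ⟨W, hW, hfin, fun y => W.smul_mem c (h y)⟩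

theorem pureSpan_mul_mem {A : Subalgebra K (G → K)} {F F' : G × G → K} (hF : F ∈ pureSpan A)
    (hF' : F' ∈ pureSpan A) : F * F' ∈ pureSpan A := by
  have h := Submodule.mul_mem_mul hF hF'
  rw [pureSpan, Submodule.span_mul_span] at h
  refine Submodule.span_mono ?_ h
  rintro _ ⟨_, ⟨a, ha, b, hb, rfl⟩, _, ⟨a', ha', b', hb', rfl⟩, rfl⟩
  exact ⟨a * a', A.mul_mem ha ha', b * b', A.mul_mem hb hb', by
    funext p
    simp [mul_mul_mul_comm]⟩

theorem mul_mem_pureSpan {A : Subalgebra K (G → K)} {a b : G → K} (ha : a ∈ A) (hb : b ∈ A) :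
    (fun p : G × G => a p.1 * b p.2) ∈ pureSpan A :=
  Submodule.subset_span ⟨a, ha, b, hb, rfl⟩

theorem exists_dual_monoidHom {N : Type*} [Monoid N] (μ : N →* K) :
    ∃ l : (N → K) →ₗ[K] K, l μ = 1 ∧ ∀ ν : N →* K, ν ≠ μ → l ν = 0 := by
  have hli := linearIndependent_monoidHom N K
  obtain ⟨l, hl⟩ := LinearMap.exists_extend ((Finsupp.lapply μ).comp hli.repr)
  have key : ∀ ν : N →* K, l ν = Finsupp.single ν (1 : K) μ := fun ν => by
    have hmem : (ν : N → K) ∈ Submodule.span K (Set.range fun f : N →* K => (f : N → K)) :=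
      Submodule.subset_span ⟨ν, rfl⟩
    have h := LinearMap.congr_fun hl ⟨ν, hmem⟩
    rw [LinearMap.comp_apply, LinearMap.comp_apply, hli.repr_eq_single ν _ rfl] at h
    simpa using h
  exact ⟨l, by simp [key], fun ν hν => by simp [key, hν]⟩

variable [Group G]

theorem exists_inv_semiInvariant (A : Subalgebra K (G → K)) (N : Subgroup G) [N.Normal]
    (hinv : ∀ f ∈ A, (fun x => f x⁻¹) ∈ A)
    (hmul : ∀ f ∈ A, (fun p : G × G => f (p.1 * p.2)) ∈ pureSpan A)
    (μ : N →* K) {f : G → K} (hf : f ∈ A) (hf1 : f 1 ≠ 0)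
    (hfμ : ∀ x, ∀ h : N, f (x * h) = μ h * f x) :
    ∃ g ∈ A, g 1 ≠ 0 ∧ ∀ x, ∀ h : N, μ h * g (x * h) = g x := by
  classical
  obtain ⟨l, hl1, hl0⟩ := exists_dual_monoidHom μ
  let conj : G → (N →* K) := fun g => μ.comp (MulAut.conjNormal g).toMonoidHom
  have hslice : ∀ y : G, (fun h : N => f (h * y⁻¹)) = f y⁻¹ • (conj y : N → K) := fun y => by
    funext h
    have : (h : G) * y⁻¹ = y⁻¹ * (MulAut.conjNormal y h : N) := by simp [mul_assoc]
    rw [this, hfμ]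
    simp [conj, mul_comm]
  have hval : ∀ y : G, l (fun h : N => f (h * y⁻¹)) = if conj y = μ then f y⁻¹ else 0 := fun y => by
    rw [hslice, map_smul]
    split_ifs with h
    · simp [h, hl1]
    · simp [hl0 _ h]
  have hconj : ∀ (x : G) (h : N), conj (x * h) = conj x := fun x h => by
    ext k
    have : MulAut.conjNormal (x * h) k = MulAut.conjNormal x (h * k * h⁻¹) := by
      ext
      simp [mul_assoc]
    change μ (MulAut.conjNormal (x * h) k) = μ (MulAut.conjNormal x k)
    rw [this, map_mul, map_mul, map_mul, map_mul μ, mul_right_comm,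
      ← map_mul μ, ← map_mul (MulAut.conjNormal x)]
    simp
  refine ⟨fun y => l fun h : N => f (h * y⁻¹),
    hinv _ (slice_mem (hmul f hf) (l.comp (LinearMap.funLeft K K ((↑) : N → G)))), ?_, fun x h => ?_⟩
  · have h1 : conj 1 = μ := by
      ext k
      simp [conj]
    change l (fun h : N => f (h * 1⁻¹)) ≠ 0
    rw [hval, if_pos h1]
    simpa using hf1
  · simp only [hval, hconj]
    split_ifs with hx
    · have h2 : (x * h)⁻¹ = x⁻¹ * (MulAut.conjNormal x h⁻¹ : N) := by simp [mul_assoc]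
      have h3 : μ (MulAut.conjNormal x h⁻¹) = μ h⁻¹ := DFunLike.congr_fun hx h⁻¹
      rw [h2, hfμ, h3, ← mul_assoc, ← map_mul]
      simp
    · simp

theorem exists_semiInvariant (A : Subalgebra K (G → K)) (N : Subgroup G) [N.Normal]
    (hinv : ∀ f ∈ A, (fun x => f x⁻¹) ∈ A)
    (hmul : ∀ f ∈ A, (fun p : G × G => f (p.1 * p.2)) ∈ pureSpan A)
    (χ : N →* K) {q : G → K} (hq : q ∈ A) (hqχ : ∀ h : N, q h = χ h) :
    ∃ f ∈ A, f 1 ≠ 0 ∧ ∀ x, ∀ h : N, f (x * h) = χ h * f x := by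
  classical
  have hq1 : q 1 = 1 := by simpa using hqχ 1
  have hleft : ∀ f ∈ A, ∀ x, (fun y => f (x * y)) ∈ A := fun f hf x =>
    slice_mem (hmul f hf) (LinearMap.proj x)
  obtain ⟨W, hWA, _, hW⟩ := exists_finite_slice (hmul q hq)
  let V : Submodule K (G → K) := Submodule.span K (Set.range fun h : N => fun x => q (x * h))
  have hVW : V ≤ W := Submodule.span_le.2 (by rintro _ ⟨h, rfl⟩; exact hW h)
  have hqV : q ∈ V := Submodule.subset_span ⟨1, by simp⟩
  have hVN : ∀ v ∈ V, ∀ h : N, v h = χ h * v 1 := fun v hv h => by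
    induction hv using Submodule.span_induction with
    | mem v hv =>
      obtain ⟨k, rfl⟩ := hv
      simpa [hqχ] using hqχ (h * k)
    | zero => simp
    | add v w _ _ hv hw => simp [hv, hw, mul_add]
    | smul c v _ hv => simp [hv, mul_left_comm]
  have hVtrans : ∀ v ∈ V, ∀ h : N, (fun x => v (x * h)) ∈ V := fun v hv h => by
    induction hv using Submodule.span_induction with
    | mem v hv =>
      obtain ⟨k, rfl⟩ := hv
      exact Submodule.subset_span ⟨h * k, by simp [mul_assoc]⟩
    | zero => exact V.zero_mem
    | add v w _ _ hv hw => exact V.add_mem hv hw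
    | smul c v _ hv => exact V.smul_mem c hv
  let U : Submodule K (G → K) := V ⊓ LinearMap.ker (LinearMap.proj (R := K) (φ := fun _ : G => K) 1)
  have hUW : U ≤ W := inf_le_left.trans hVW
  have : FiniteDimensional K U := Submodule.finiteDimensional_of_le hUW
  have hUtrans : ∀ v ∈ U, ∀ h : N, (fun x => v (x * h)) ∈ U := fun v hv h =>
    ⟨hVtrans v hv.1 h, by
      have h0 : v 1 = 0 := hv.2
      simp [hVN v hv.1, h0]⟩
  have hqU : ∀ h : N, (fun x => q (x * h)) - χ h • q ∈ U := fun h =>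
    ⟨V.sub_mem (hVtrans q hqV h) (V.smul_mem _ hqV), by simp [hqχ, hq1]⟩
  let b := Module.finBasis K U
  let u : Fin (Module.finrank K U) → G → K := fun i => b i
  have hu : LinearIndependent K u := b.linearIndependent.map' U.subtype (Submodule.ker_subtype U)
  have huA : ∀ i, u i ∈ A := fun i => hWA (hUW (b i).2)
  have hu1 : ∀ i, u i 1 = 0 := fun i => (b i).2.2
  have hexp : ∀ v (hv : v ∈ U) x, v x = ∑ k, b.repr ⟨v, hv⟩ k * u k x := fun v hv x => by
    have h := congrArg (fun w : U => (w : G → K) x) (b.sum_repr ⟨v, hv⟩)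
    refine h.symm.trans ?_
    simp [-Module.Basis.sum_repr, u, Finset.sum_apply]
  obtain ⟨p, hp⟩ := exists_det_apply_ne_zero hu
  let M : G → Matrix (Fin (Module.finrank K U)) (Fin (Module.finrank K U)) K :=
    fun x => Matrix.of fun i j => u i (p j * x)
  let B : N → Matrix (Fin (Module.finrank K U)) (Fin (Module.finrank K U)) K :=
    fun h => Matrix.of fun i k => b.repr ⟨_, hUtrans _ (b i).2 h⟩ k
  have hB : ∀ (h : N) i x, u i (x * h) = ∑ k, B h i k * u k x := fun h i x =>
    hexp _ (hUtrans _ (b i).2 h) x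
  let r : N → Matrix Unit (Fin (Module.finrank K U)) K :=
    fun h => Matrix.of fun _ k => b.repr ⟨_, hqU h⟩ k
  have hr : ∀ (h : N) x, q (x * h) = χ h * q x + ∑ k, r h () k * u k x := fun h x => by
    have := hexp _ (hqU h) x
    simp only [Pi.sub_apply, Pi.smul_apply, smul_eq_mul] at this
    rw [sub_eq_iff_eq_add'] at this
    exact this
  let P : G → Matrix (Unit ⊕ Fin (Module.finrank K U)) (Unit ⊕ Fin (Module.finrank K U)) K :=
    fun x => Matrix.fromBlocks (Matrix.of fun _ _ => q x) (Matrix.of fun _ j => q (p j * x))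
      (Matrix.of fun i _ => u i x) (M x)
  have hM : ∀ x (h : N), (M (x * h)).det = (B h).det * (M x).det := fun x h => by
    rw [← Matrix.det_mul]
    congr 1
    ext i j
    simp [M, Matrix.mul_apply, ← mul_assoc, hB]
  have hP : ∀ x (h : N), (P (x * h)).det = χ h * (B h).det * (P x).det := fun x h => by
    have : P (x * h) =
        Matrix.fromBlocks (Matrix.of fun _ _ => χ h) (r h) 0 (B h) * P x := by
      rw [Matrix.fromBlocks_multiply]
      ext (i | i) (j | j) <;> simp [P, M, Matrix.mul_apply, ← mul_assoc, hB, hr]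
    rw [this, Matrix.det_mul, Matrix.det_fromBlocks_zero₂₁]
    simp
  have hM1 : (M 1).det ≠ 0 := by simpa [M] using hp
  have hP1 : (P 1).det = (M 1).det := by
    have : P 1 = Matrix.fromBlocks (Matrix.of fun _ _ => 1) (Matrix.of fun _ j => q (p j * 1))
        0 (M 1) := by
      simp only [P]
      congr 1 <;> ext i j <;> simp [hq1, hu1]
    rw [this, Matrix.det_fromBlocks_zero₂₁]
    simp
  have hMA : (fun x => (M x).det) ∈ A := det_mem A M fun i j => hleft _ (huA i) (p j)
  have hPA : (fun x => (P x).det) ∈ A := by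
    refine det_mem A P ?_
    rintro (i | i) (j | j)
    · exact hq
    · exact hleft _ hq (p j)
    · exact huA i
    · exact hleft _ (huA i) (p j)
  let μ : N →* K :=
    { toFun := fun h => (B h).det
      map_one' := by
        have := hM 1 1
        simpa [hM1] using this
      map_mul' := fun h k => by
        have h1 := hM 1 (h * k)
        have h2 := hM (1 * h) k
        rw [hM 1 h] at h2
        refine mul_right_cancel₀ hM1 ?_
        rw [← h1, mul_comm (B h).det, mul_assoc, ← h2]
        simp }
  obtain ⟨g, hgA, hg1, hg⟩ := exists_inv_semiInvariant A N hinv hmul μ hMA hM1 hM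
  refine ⟨_, A.mul_mem hPA hgA, ?_, fun x h => ?_⟩
  · simpa [hP1] using ⟨hM1, hg1⟩
  · simp only [Pi.mul_apply, hP]
    rw [← hg x h]
    simp only [μ, MonoidHom.coe_mk, OneHom.coe_mk]
    ring

section GeneralLinear

variable {n : ℕ} (H : Subgroup (Matrix.GeneralLinearGroup (Fin n) K))

/-- The coordinate ring of a subgroup of `GL n`, as an algebra of functions on it. -/
def coordinateRing : Subalgebra K (H → K) :=
  Algebra.adjoin K (Set.range (fun (ij : Fin n × Fin n) (g : H) =>
      ((g : Matrix.GeneralLinearGroup (Fin n) K) : Matrix (Fin n) (Fin n) K) ij.1 ij.2) ∪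
    {fun g : H => (((g : Matrix.GeneralLinearGroup (Fin n) K) : Matrix (Fin n) (Fin n) K).det)⁻¹})

theorem coord_mem (i j : Fin n) :
    (fun g : H => ((g : Matrix.GeneralLinearGroup (Fin n) K) : Matrix (Fin n) (Fin n) K) i j) ∈
      coordinateRing H :=
  Algebra.subset_adjoin (Or.inl ⟨(i, j), rfl⟩)

theorem det_inv_mem :
    (fun g : H => (((g : Matrix.GeneralLinearGroup (Fin n) K) :
      Matrix (Fin n) (Fin n) K).det)⁻¹) ∈ coordinateRing H :=
  Algebra.subset_adjoin (Or.inr rfl)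

theorem eval_mem (p : MvPolynomial (Fin n × Fin n) K) :
    (fun g : H => eval (fun ij => ((g : Matrix.GeneralLinearGroup (Fin n) K) :
      Matrix (Fin n) (Fin n) K) ij.1 ij.2) p) ∈ coordinateRing H := by
  induction p using MvPolynomial.induction_on with
  | C a =>
    simp only [eval_C]
    exact (coordinateRing H).algebraMap_mem a
  | add p q hp hq =>
    simp only [map_add]
    exact add_mem hp hq
  | mul_X p i hp =>
    simp only [map_mul, eval_X]
    exact mul_mem hp (coord_mem H i.1 i.2)

theorem coordinateRing_inv_mem {f : H → K} (hf : f ∈ coordinateRing H) :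
    (fun x => f x⁻¹) ∈ coordinateRing H := by
  induction hf using Algebra.adjoin_induction with
  | mem f hf =>
    rcases hf with ⟨⟨i, j⟩, rfl⟩ | rfl
    · have hadj : (fun g : H => ((g : Matrix.GeneralLinearGroup (Fin n) K) :
          Matrix (Fin n) (Fin n) K).adjugate i j) ∈ coordinateRing H := by
        simp only [Matrix.adjugate_apply]
        refine det_mem _ _ fun k l => ?_
        by_cases hk : k = j
        · subst hk
          simp only [Matrix.updateRow_self]
          exact (coordinateRing H).algebraMap_mem _
        · simp only [Matrix.updateRow_ne hk]
          exact coord_mem H k l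
      convert mul_mem (det_inv_mem H) hadj using 1
      funext g
      simp [Matrix.coe_units_inv, Matrix.inv_def, Ring.inverse_eq_inv']
    · convert det_mem (coordinateRing H) _ (coord_mem H) using 1
      funext g
      simp [Matrix.coe_units_inv, Matrix.det_nonsing_inv, Ring.inverse_eq_inv']
  | algebraMap r => exact (coordinateRing H).algebraMap_mem r
  | add f g _ _ hf hg => exact add_mem hf hg
  | mul f g _ _ hf hg => exact mul_mem hf hg

theorem coordinateRing_comp_mul_mem {f : H → K} (hf : f ∈ coordinateRing H) :
    (fun p : H × H => f (p.1 * p.2)) ∈ pureSpan (coordinateRing H) := by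
  induction hf using Algebra.adjoin_induction with
  | mem f hf =>
    rcases hf with ⟨⟨i, j⟩, rfl⟩ | rfl
    · convert sum_mem fun k (_ : k ∈ Finset.univ) =>
        mul_mem_pureSpan (coord_mem H i k) (coord_mem H k j) using 1
      funext p
      simp [Matrix.mul_apply, Finset.sum_apply]
    · convert mul_mem_pureSpan (det_inv_mem H) (det_inv_mem H) using 1
      funext p
      simp [mul_comm]
  | algebraMap r =>
    convert mul_mem_pureSpan ((coordinateRing H).algebraMap_mem r) (one_mem _) using 1
    funext p
    simp
  | add f g _ _ hf hg => exact add_mem hf hg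
  | mul f g _ _ hf hg => exact pureSpan_mul_mem hf hg

theorem exists_mul_det_pow_eq_eval {f : H → K} (hf : f ∈ coordinateRing H) :
    ∃ (p : MvPolynomial (Fin n × Fin n) K) (k : ℕ), ∀ g : H,
      f g * ((g : Matrix.GeneralLinearGroup (Fin n) K) : Matrix (Fin n) (Fin n) K).det ^ k =
        eval (fun ij => ((g : Matrix.GeneralLinearGroup (Fin n) K) :
          Matrix (Fin n) (Fin n) K) ij.1 ij.2) p := by
  have hdet : ∀ M : Matrix (Fin n) (Fin n) K,
      eval (fun ij => M ij.1 ij.2) (Matrix.mvPolynomialX (Fin n) (Fin n) K).det = M.det := by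
    intro M
    rw [RingHom.map_det]
    congr 1
    ext i j
    simp
  induction hf using Algebra.adjoin_induction with
  | mem f hf =>
    rcases hf with ⟨⟨i, j⟩, rfl⟩ | rfl
    · exact ⟨X (i, j), 0, fun g => by simp⟩
    · exact ⟨1, 1, fun g => by
        simpa using inv_mul_cancel₀ (Matrix.GeneralLinearGroup.det_ne_zero g.1)⟩
  | algebraMap r => exact ⟨C r, 0, fun g => by simp⟩
  | add f g _ _ hf hg =>
    obtain ⟨p, k, hp⟩ := hf
    obtain ⟨q, l, hq⟩ := hg
    refine ⟨p * (Matrix.mvPolynomialX (Fin n) (Fin n) K).det ^ l +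
      q * (Matrix.mvPolynomialX (Fin n) (Fin n) K).det ^ k, k + l, fun x => ?_⟩
    simp only [map_add, map_mul, map_pow, hdet, ← hp, ← hq, Pi.add_apply]
    ring
  | mul f g _ _ hf hg =>
    obtain ⟨p, k, hp⟩ := hf
    obtain ⟨q, l, hq⟩ := hg
    refine ⟨p * q, k + l, fun x => ?_⟩
    simp only [map_mul, ← hp, ← hq, Pi.mul_apply]
    ring

end GeneralLinear

end RegularFunctions

/-- Crespo–Hajto (Prop. 6.3.5): let H be a (Zariski-closed) linear algebraic
group over an algebraically closed field C of characteristic zero, N ⊴ H a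
closed normal subgroup, and χ a character of N given by a regular function.
Then C[H] contains a nonzero χ-semi-invariant for the right translation action
of N: a regular function a (given by a polynomial p and a power k of 1/det)
not vanishing identically on H with h·a = χ(h)a for all h ∈ N. -/
theorem stmt_19 (C : Type*) [Field C] [IsAlgClosed C] [CharZero C] (n : ℕ)
    (Hs Ns : Subgroup (Matrix.GeneralLinearGroup (Fin n) C))
    (hNH : Ns ≤ Hs)
    (hnorm : ∀ h ∈ Hs, ∀ y ∈ Ns, h * y * h⁻¹ ∈ Ns)
    -- H and N are Zariski closed subgroups of GL_n
    (SH SN : Set (MvPolynomial (Fin n × Fin n) C))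
    (hHclosed : ∀ g : Matrix.GeneralLinearGroup (Fin n) C, g ∈ Hs ↔
      ∀ p ∈ SH, eval (fun ij => (g : Matrix (Fin n) (Fin n) C) ij.1 ij.2) p = 0)
    (hNclosed : ∀ g : Matrix.GeneralLinearGroup (Fin n) C, g ∈ Ns ↔
      ∀ p ∈ SN, eval (fun ij => (g : Matrix (Fin n) (Fin n) C) ij.1 ij.2) p = 0)
    -- χ is a character of N, regular as a function on N
    (χ : Matrix.GeneralLinearGroup (Fin n) C → C)
    (hχ1 : χ 1 = 1)
    (hχmul : ∀ a ∈ Ns, ∀ b ∈ Ns, χ (a * b) = χ a * χ b)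
    (hχ0 : ∀ a ∈ Ns, χ a ≠ 0)
    (hχreg : ∃ (q : MvPolynomial (Fin n × Fin n) C) (k : ℕ), ∀ a ∈ Ns,
      χ a * ((a : Matrix (Fin n) (Fin n) C).det) ^ k =
        eval (fun ij => (a : Matrix (Fin n) (Fin n) C) ij.1 ij.2) q) :
    ∃ (p : MvPolynomial (Fin n × Fin n) C) (k : ℕ),
      (∃ h ∈ Hs, eval (fun ij => (h : Matrix (Fin n) (Fin n) C) ij.1 ij.2) p ≠ 0) ∧
      ∀ y ∈ Ns, ∀ h ∈ Hs,
        eval (fun ij => ((h * y : Matrix.GeneralLinearGroup (Fin n) C) :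
            Matrix (Fin n) (Fin n) C) ij.1 ij.2) p *
          ((h : Matrix (Fin n) (Fin n) C).det) ^ k =
        χ y * eval (fun ij => (h : Matrix (Fin n) (Fin n) C) ij.1 ij.2) p *
          (((h * y : Matrix.GeneralLinearGroup (Fin n) C) :
            Matrix (Fin n) (Fin n) C).det) ^ k := by
  obtain ⟨q, k, hq⟩ := hχreg
  have hdet : ∀ g : Matrix.GeneralLinearGroup (Fin n) C,
      (g : Matrix (Fin n) (Fin n) C).det ≠ 0 := fun g => Matrix.GeneralLinearGroup.det_ne_zero g
  let N : Subgroup Hs := Ns.subgroupOf Hs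
  have hN : N.Normal := ⟨fun y hy g => hnorm g g.2 y hy⟩
  let ψ : N →* C :=
    { toFun := fun y => χ y
      map_one' := hχ1
      map_mul' := fun a b => hχmul _ a.2 _ b.2 }
  obtain ⟨f, hfA, hf1, hf⟩ := RegularFunctions.exists_semiInvariant
    (RegularFunctions.coordinateRing Hs) N
    (fun _ h => RegularFunctions.coordinateRing_inv_mem Hs h)
    (fun _ h => RegularFunctions.coordinateRing_comp_mul_mem Hs h) ψ
    (mul_mem (RegularFunctions.eval_mem Hs q) (pow_mem (RegularFunctions.det_inv_mem Hs) k))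
    (fun y => by
      simp only [Pi.mul_apply, Pi.pow_apply]
      have hy : (y : Matrix.GeneralLinearGroup (Fin n) C) ∈ Ns := y.2
      rw [← hq _ hy, mul_assoc, ← mul_pow, mul_inv_cancel₀ (hdet _), one_pow, mul_one]
      rfl)
  obtain ⟨p, m, hp⟩ := RegularFunctions.exists_mul_det_pow_eq_eval Hs hfA
  refine ⟨p, m, ⟨1, Hs.one_mem, ?_⟩, fun y hy h hh => ?_⟩
  · have := hp 1
    rw [OneMemClass.coe_one] at this
    rw [← this]
    exact mul_ne_zero hf1 (pow_ne_zero _ (hdet _))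
  · have h1 := hp ⟨h, hh⟩
    have h2 := hp ⟨h * y, Hs.mul_mem hh (hNH hy)⟩
    have h3 : f ⟨h * y, Hs.mul_mem hh (hNH hy)⟩ = χ y * f ⟨h, hh⟩ :=
      hf ⟨h, hh⟩ ⟨⟨y, hNH hy⟩, hy⟩
    rw [← h1, ← h2, h3]
    ring
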